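/- arXiv:1903.03818 — 2 statements merged into one kernel-verified Lean document; each statement's English description precedes it below -/
import Mathlib

section
/- For any finite group G and natural number n dividing the order of G, n divides the number of elements g in G satisfying g^n = 1. -/
open Finset

universe u

theorem fro_fiber {α β : Type*} [DecidableEq β] (s : Finset α) (π : α → β) (f : α → ℕ) (d : ℕ)
    (hf : ∀ x ∈ s, ∀ y ∈ s, π x = π y → f x = f y)
    (hd : ∀ y ∈ s, d ∣ #{x ∈ s | π x = π y} * f y) : d ∣ ∑ x ∈ s, f x := by
  rw [← Finset.sum_fiberwise_of_maps_to (t := s.image π) (g := π)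
    (fun x hx => Finset.mem_image_of_mem π hx)]
  refine Finset.dvd_sum ?_
  intro b hb
  obtain ⟨y, hy, rfl⟩ := Finset.mem_image.1 hb
  have : ∑ x ∈ s with π x = π y, f x = #{x ∈ s | π x = π y} * f y := by
    rw [Finset.sum_const_nat]
    intro x hx
    rw [Finset.mem_filter] at hx
    exact hf x hx.1 y hy hx.2
  rw [this]
  exact hd y hy

theorem fro_order {G : Type*} [Group G] [Fintype G] [DecidableEq G] (n : ℕ) :
    n.totient ∣ #{g : G | orderOf g = n} := by
  classical
  rw [Finset.card_eq_sum_ones]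
  refine fro_fiber _ (fun g : G => Subgroup.zpowers g) _ _ (fun _ _ _ _ _ => rfl) ?_
  intro y hy
  simp only [Finset.mem_filter, Finset.mem_univ, true_and] at hy
  rw [mul_one]
  have h1 := IsCyclic.card_orderOf_eq_totient (α := Subgroup.zpowers y) (d := n)
    (by rw [Fintype.card_zpowers, hy])
  rw [← h1]
  apply dvd_of_eq
  refine Finset.card_bij (fun x _ => (x : G)) ?_ ?_ ?_
  · intro x hx
    simp only [Finset.mem_filter, Finset.mem_univ, true_and] at hx ⊢
    have hx' : orderOf (x : G) = n := by rw [Subgroup.orderOf_coe, hx]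
    refine ⟨hx', ?_⟩
    apply Subgroup.eq_of_le_of_card_ge
    · rw [Subgroup.zpowers_le]; exact x.2
    · rw [Nat.card_zpowers, Nat.card_zpowers, hx', hy]
  · intro a _ b _ h
    exact Subtype.ext h
  · intro b hb
    simp only [Finset.mem_filter, Finset.mem_univ, true_and] at hb
    refine ⟨⟨b, hb.2 ▸ Subgroup.mem_zpowers b⟩, ?_, rfl⟩
    simp only [Finset.mem_filter, Finset.mem_univ, true_and]
    rw [Subgroup.orderOf_mk, hb.1]

/-- number of solutions of `g ^ n = 1`. -/
noncomputable def froCount (G : Type*) [Group G] (n : ℕ) : ℕ := Nat.card {g : G // g ^ n = 1}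

theorem fro_gcd {H : Type*} [Group H] [Finite H] (n k : ℕ)
    (h : n.gcd (Nat.card H) ∣ froCount H (n.gcd (Nat.card H))) (hk : n ∣ k * Nat.card H) :
    n ∣ k * froCount H n := by
  have e : froCount H (n.gcd (Nat.card H)) = froCount H n := by
    unfold froCount
    apply Nat.card_congr
    refine Equiv.subtypeEquivRight fun x => ?_
    rw [pow_gcd_eq_one]
    simp
  rw [e] at h
  have : n ∣ k * n.gcd (Nat.card H) := by
    rw [← Nat.gcd_mul_left]
    exact Nat.dvd_gcd (Dvd.intro_left _ rfl) hk
  exact this.trans (mul_dvd_mul_left k h)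

theorem fro_decomp {G : Type*} [Group G] [Fintype G] [DecidableEq G] (q m : ℕ)
    (hqm : q.Coprime m) :
    froCount G (q * m) = ∑ y : G with y ^ m = 1, froCount (Subgroup.centralizer {y}) q := by
  classical
  have h1 : ∀ y : G, froCount (Subgroup.centralizer {y}) q = #{x : G | x ^ q = 1 ∧ Commute y x} := by
    intro y
    rw [froCount, ← Fintype.card_subtype, ← Nat.card_eq_fintype_card]
    refine Nat.card_congr ⟨fun x => ⟨x.1.1, ?_, ?_⟩, fun x => ⟨⟨x.1, ?_⟩, ?_⟩, ?_, ?_⟩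
    · simpa using congrArg Subtype.val x.2
    · exact Subgroup.mem_centralizer_singleton_iff.1 x.1.2 |> fun h => h.symm
    · exact Subgroup.mem_centralizer_singleton_iff.2 x.2.2.symm
    · exact Subtype.ext x.2.1
    · intro x; rfl
    · intro x; rfl
  simp_rw [h1]
  rw [← Finset.card_sigma, froCount, Nat.card_eq_fintype_card, Fintype.card_subtype]
  obtain ⟨e, he1, he2⟩ := Nat.chineseRemainder hqm 0 1
  obtain ⟨f, hf1, hf2⟩ := Nat.chineseRemainder hqm 1 0
  have key : ∀ (k r j : ℕ) (x : G), k ≡ r [MOD j] → x ^ j = 1 → x ^ k = x ^ r := by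
    intro k r j x h hx
    rw [pow_eq_pow_iff_modEq]
    exact h.of_dvd (orderOf_dvd_of_pow_eq_one hx)
  symm
  refine Finset.card_bij (fun z _ => z.2 * z.1) ?_ ?_ ?_
  · rintro ⟨y, x⟩ h
    simp only [Finset.mem_sigma, Finset.mem_filter, Finset.mem_univ, true_and] at h ⊢
    obtain ⟨hy, hx, hc⟩ := h
    rw [hc.symm.mul_pow, pow_mul, hx, mul_comm q m, pow_mul, hy]; simp
  · rintro ⟨y, x⟩ h ⟨y', x'⟩ h' hh
    simp only [Finset.mem_sigma, Finset.mem_filter, Finset.mem_univ, true_and] at h h' hh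
    obtain ⟨hy, hx, hc⟩ := h
    obtain ⟨hy', hx', hc'⟩ := h'
    have a : y = y' := by
      have := congrArg (· ^ e) hh
      simp only [hc.symm.mul_pow, hc'.symm.mul_pow] at this
      simpa [key _ _ _ _ he1 hx, key _ _ _ _ he1 hx', key _ _ _ _ he2 hy, key _ _ _ _ he2 hy']
        using this
    subst a
    have := mul_right_cancel hh
    subst this
    rfl
  · intro g hg
    simp only [Finset.mem_filter, Finset.mem_univ, true_and] at hg
    refine ⟨⟨g ^ e, g ^ f⟩, ?_, ?_⟩
    · simp only [Finset.mem_sigma, Finset.mem_filter, Finset.mem_univ, true_and]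
      refine ⟨?_, ?_, (Commute.refl g).pow_pow _ _⟩
      · obtain ⟨c, rfl⟩ := (Nat.modEq_zero_iff_dvd.1 he1)
        rw [← pow_mul, show q * c * m = (q * m) * c by ring, pow_mul, hg, one_pow]
      · obtain ⟨c, rfl⟩ := (Nat.modEq_zero_iff_dvd.1 hf2)
        rw [← pow_mul, show m * c * q = (q * m) * c by ring, pow_mul, hg, one_pow]
    · change g ^ f * g ^ e = g
      rw [← pow_add]
      have : f + e ≡ 1 [MOD q * m] :=
        (Nat.modEq_and_modEq_iff_modEq_mul hqm).1 ⟨hf1.add he1, hf2.add he2⟩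
      simpa using key _ _ _ _ this hg

theorem fro_conj {G : Type*} [Group G] [Finite G] (q : ℕ) (x y : G) (h : IsConj x y) :
    froCount (Subgroup.centralizer {x}) q = froCount (Subgroup.centralizer {y}) q := by
  obtain ⟨c, rfl⟩ := isConj_iff.1 h
  refine Nat.card_congr ⟨fun z => ⟨⟨c * z.1.1 * c⁻¹, ?_⟩, ?_⟩,
    fun z => ⟨⟨c⁻¹ * z.1.1 * c, ?_⟩, ?_⟩, ?_, ?_⟩
  · have := Subgroup.mem_centralizer_singleton_iff.1 z.1.2
    rw [Subgroup.mem_centralizer_singleton_iff]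
    have := congrArg (fun t => c * t * c⁻¹) this
    simpa [mul_assoc] using this
  · have := congrArg Subtype.val z.2
    apply Subtype.ext
    simp at this ⊢
    exact this
  · have := Subgroup.mem_centralizer_singleton_iff.1 z.1.2
    rw [Subgroup.mem_centralizer_singleton_iff]
    have := congrArg (fun t => c⁻¹ * t * c) this
    simpa [mul_assoc] using this
  · have := congrArg Subtype.val z.2
    apply Subtype.ext
    have h2 := conj_pow (i := q) (a := c⁻¹) (b := z.1.1)
    simp at this h2 ⊢
    rw [h2, this]; simp
  · intro z; ext; simp [mul_assoc]
  · intro z; ext; simp [mul_assoc]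

theorem fro_class {G : Type*} [Group G] [Finite G] (y : G) :
    Nat.card (ConjClasses.mk y).carrier * Nat.card (Subgroup.centralizer {y}) = Nat.card G := by
  rw [Subgroup.nat_card_centralizer_nat_card_stabilizer, ← ConjAct.orbit_eq_carrier_conjClasses,
    ← Nat.card_prod]
  exact Nat.card_congr (MulAction.orbitProdStabilizerEquivGroup (ConjAct G) y)

theorem fro_sum {G : Type*} [Group G] [Fintype G] [DecidableEq G] (q : ℕ) (s : Finset G)
    (hq : q ∣ Nat.card G) (hs : ∀ x y, IsConj x y → x ∈ s → y ∈ s)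
    (h : ∀ y ∈ s, q.gcd (Nat.card (Subgroup.centralizer {y})) ∣
      froCount (Subgroup.centralizer {y}) (q.gcd (Nat.card (Subgroup.centralizer {y})))) :
    q ∣ ∑ y ∈ s, froCount (Subgroup.centralizer {y}) q := by
  classical
  refine fro_fiber s ConjClasses.mk _ q ?_ ?_
  · intro x _ y _ hxy
    exact fro_conj q x y (ConjClasses.mk_eq_mk_iff_isConj.1 hxy)
  · intro y hy
    refine fro_gcd q _ (h y hy) ?_
    have : #{x ∈ s | ConjClasses.mk x = ConjClasses.mk y} = Nat.card (ConjClasses.mk y).carrier := by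
      rw [Nat.card_coe_set_eq, ← Set.ncard_coe_finset]
      congr 1
      ext x
      simp only [Finset.coe_filter, Set.mem_ofPred_eq, ConjClasses.mem_carrier_iff_mk_eq,
        and_iff_right_iff_imp]
      intro hx
      exact hs y x (ConjClasses.mk_eq_mk_iff_isConj.1 hx).symm hy
    rw [this, fro_class]
    exact hq

theorem fro_center {G : Type*} [Group G] [Fintype G] [DecidableEq G] (p m : ℕ) (hp : p.Prime)
    (hpm : ¬ p ∣ m) : ¬ p ∣ #{y : G | y ^ m = 1 ∧ y ∈ Subgroup.center G} := by
  classical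
  let K : Subgroup G :=
    { carrier := {y | y ^ m = 1 ∧ y ∈ Subgroup.center G}
      one_mem' := ⟨one_pow m, Subgroup.one_mem _⟩
      mul_mem' := by
        rintro a b ⟨ha, ha'⟩ ⟨hb, hb'⟩
        refine ⟨?_, Subgroup.mul_mem _ ha' hb'⟩
        have hc : Commute a b := Subgroup.mem_center_iff.1 hb' a
        rw [hc.mul_pow, ha, hb, one_mul]
      inv_mem' := by
        rintro a ⟨ha, ha'⟩
        exact ⟨by rw [inv_pow, ha, inv_one], Subgroup.inv_mem _ ha'⟩ }
  have hK : Nat.card K = #{y : G | y ^ m = 1 ∧ y ∈ Subgroup.center G} := by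
    rw [← Fintype.card_subtype, ← Nat.card_eq_fintype_card]
    rfl
  rw [← hK]
  intro h
  have := Fact.mk hp
  obtain ⟨x, hx⟩ := exists_prime_orderOf_dvd_card' p h
  apply hpm
  rw [← hx]
  apply orderOf_dvd_of_pow_eq_one
  apply Subtype.ext
  exact x.2.1

theorem fro_full {G : Type*} [Group G] [Finite G] (p A m : ℕ) (hp : p.Prime)
    (hpm : ¬ p ∣ m) (hG : Nat.card G = p ^ A * m)
    (ih : ∀ y : G, y ∉ Subgroup.center G → ∀ a, p ^ a ∣ Nat.card (Subgroup.centralizer {y}) →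
      p ^ a ∣ froCount (Subgroup.centralizer {y}) (p ^ a)) :
    p ^ A ∣ froCount G (p ^ A) := by
  classical
  have := Fintype.ofFinite G
  have hcop : (p ^ A).Coprime m := Nat.Coprime.pow_left _ ((Nat.Prime.coprime_iff_not_dvd hp).2 hpm)
  have h0 := fro_decomp (G := G) (p ^ A) m hcop
  have h1 : froCount G (p ^ A * m) = Nat.card G := by
    rw [← hG]
    exact Nat.card_congr (Equiv.subtypeUnivEquiv fun x => pow_card_eq_one')
  rw [h1, ← Finset.sum_filter_add_sum_filter_not _ (fun y => y ∈ Subgroup.center G),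
    Finset.filter_filter, Finset.filter_filter] at h0
  have h2 : p ^ A ∣ ∑ y : G with y ^ m = 1 ∧ y ∉ Subgroup.center G,
      froCount (Subgroup.centralizer {y}) (p ^ A) := by
    apply fro_sum
    · exact ⟨m, hG⟩
    · intro x y hxy hx
      obtain ⟨c, rfl⟩ := isConj_iff.1 hxy
      simp only [Finset.mem_filter, Finset.mem_univ, true_and] at hx ⊢
      refine ⟨by rw [conj_pow, hx.1]; simp, fun h => hx.2 ?_⟩
      have := Subgroup.Normal.conj_mem inferInstance _ h c⁻¹
      simpa [mul_assoc] using this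
    · intro y hy
      simp only [Finset.mem_filter, Finset.mem_univ, true_and] at hy
      obtain ⟨b, _, hb⟩ := (Nat.dvd_prime_pow hp).1
        (Nat.gcd_dvd_left (p ^ A) (Nat.card (Subgroup.centralizer {y})))
      have := Nat.gcd_dvd_right (p ^ A) (Nat.card (Subgroup.centralizer {y}))
      rw [hb] at this ⊢
      exact ih y hy.2 b this
  have h3 : p ^ A ∣ ∑ y : G with y ^ m = 1 ∧ y ∈ Subgroup.center G,
      froCount (Subgroup.centralizer {y}) (p ^ A) :=
    (Nat.dvd_add_left h2).1 (h0 ▸ ⟨m, hG⟩)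
  rw [Finset.sum_const_nat (m := froCount G (p ^ A))] at h3
  · refine Nat.Coprime.dvd_of_dvd_mul_left ?_ h3
    exact Nat.Coprime.pow_left _ ((Nat.Prime.coprime_iff_not_dvd hp).2 (fro_center p m hp hpm))
  · intro y hy
    simp only [Finset.mem_filter, Finset.mem_univ, true_and] at hy
    have ht : ∀ x : G, x ∈ Subgroup.centralizer {y} := fun x =>
      Subgroup.mem_centralizer_singleton_iff.2 (Subgroup.mem_center_iff.1 hy.2 x)
    refine Nat.card_congr ⟨fun x => ⟨x.1.1, ?_⟩, fun x => ⟨⟨x.1, ht _⟩, ?_⟩, ?_, ?_⟩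
    · simpa using congrArg Subtype.val x.2
    · exact Subtype.ext x.2
    · intro x; rfl
    · intro x; rfl

theorem fro_step {G : Type*} [Group G] [Finite G] (p a : ℕ) (hp : p.Prime)
    (h : p ^ (a + 1) ∣ froCount G (p ^ (a + 1))) : p ^ a ∣ froCount G (p ^ a) := by
  classical
  have := Fintype.ofFinite G
  have := Fact.mk hp
  have h1 : p ^ a ∣ #{g : G | orderOf g = p ^ (a + 1)} := by
    refine Dvd.dvd.trans ?_ (fro_order _)
    rw [Nat.totient_prime_pow_succ hp]
    exact Dvd.intro _ rfl
  have h2 : froCount G (p ^ (a + 1)) = froCount G (p ^ a) + #{g : G | orderOf g = p ^ (a + 1)} := by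
    simp only [froCount, Nat.card_eq_fintype_card, Fintype.card_subtype]
    rw [← Finset.card_union_of_disjoint]
    · congr 1
      ext g
      simp only [Finset.mem_filter, Finset.mem_univ, true_and, Finset.mem_union]
      constructor
      · intro hg
        by_cases h : g ^ p ^ a = 1
        · exact Or.inl h
        · exact Or.inr (orderOf_eq_prime_pow h hg)
      · rintro (h | h)
        · rw [pow_succ, pow_mul, h, one_pow]
        · rw [← h, pow_orderOf_eq_one]
    · rw [Finset.disjoint_left]
      intro g hg hg'
      simp only [Finset.mem_filter, Finset.mem_univ, true_and] at hg hg'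
      have := orderOf_dvd_of_pow_eq_one hg
      rw [hg', Nat.pow_dvd_pow_iff_le_right hp.one_lt] at this
      omega
  rw [h2] at h
  exact (Nat.dvd_add_left h1).1 ((pow_dvd_pow p (Nat.le_succ a)).trans h)

theorem fro_prime_pow (p : ℕ) (hp : p.Prime) (k : ℕ) : ∀ (G : Type u) [Group G] [Finite G],
    Nat.card G = k → ∀ a, p ^ a ∣ Nat.card G → p ^ a ∣ froCount G (p ^ a) := by
  induction k using Nat.strong_induction_on with
  | _ k ih =>
    intro G _ _ hk a ha
    obtain ⟨A, m, hpm, hG⟩ := Nat.exists_eq_pow_mul_and_not_dvd (n := Nat.card G)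
      Nat.card_pos.ne' p hp.ne_one
    have hfull := fro_full p A m hp hpm hG (by
      intro y hy b hb
      refine ih _ ?_ (Subgroup.centralizer {y}) rfl b hb
      rw [← hk]
      refine lt_of_le_of_ne (Subgroup.card_le_card_group _) fun h => hy ?_
      have := Subgroup.eq_top_of_card_eq _ h
      rw [Subgroup.mem_center_iff]
      intro g
      exact Subgroup.mem_centralizer_singleton_iff.1 (this ▸ Subgroup.mem_top g))
    have haA : a ≤ A := by
      rw [hG] at ha
      have := Nat.Coprime.dvd_of_dvd_mul_right
        (Nat.Coprime.pow_left a ((Nat.Prime.coprime_iff_not_dvd hp).2 hpm)) ha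
      exact (Nat.pow_dvd_pow_iff_le_right hp.one_lt).1 this
    exact Nat.decreasingInduction (motive := fun b _ => p ^ b ∣ froCount G (p ^ b))
      (fun b _ hb => fro_step p b hp hb) hfull haA

/-- **Frobenius' theorem (1907).** If `n` divides the order of a finite group `G`,
then `n` divides the number of elements `g` of `G` with `g ^ n = 1`. -/
theorem frobenius_divisibility (G : Type*) [Group G] [Finite G] (n : ℕ)
    (hn : n ∣ Nat.card G) : n ∣ Nat.card {g : G | g ^ n = 1} := by
  classical
  have := Fintype.ofFinite G
  change n ∣ froCount G n
  have hn0 : n ≠ 0 := by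
    rintro rfl
    exact Nat.card_pos.ne' (zero_dvd_iff.1 hn)
  rw [Nat.dvd_iff_prime_pow_dvd_dvd]
  intro p k hp hk
  obtain ⟨a, m, hpm, hnm⟩ := Nat.exists_eq_pow_mul_and_not_dvd (n := n) hn0 p hp.ne_one
  have hcop : ∀ b, (p ^ b).Coprime m := fun b =>
    Nat.Coprime.pow_left _ ((Nat.Prime.coprime_iff_not_dvd hp).2 hpm)
  have hka : p ^ k ∣ p ^ a := (hcop k).dvd_of_dvd_mul_right (hnm ▸ hk)
  refine hka.trans ?_
  rw [hnm, fro_decomp _ _ (hcop a)]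
  apply fro_sum
  · exact (Dvd.intro _ hnm.symm).trans hn
  · intro x y hxy hx
    obtain ⟨c, rfl⟩ := isConj_iff.1 hxy
    simp only [Finset.mem_filter, Finset.mem_univ, true_and] at hx ⊢
    rw [conj_pow, hx]; simp
  · intro y _
    obtain ⟨b, _, hb⟩ := (Nat.dvd_prime_pow hp).1
      (Nat.gcd_dvd_left (p ^ a) (Nat.card (Subgroup.centralizer {y})))
    have := Nat.gcd_dvd_right (p ^ a) (Nat.card (Subgroup.centralizer {y}))
    rw [hb] at this ⊢
    exact fro_prime_pow p hp _ _ rfl b this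
end

section
/- The number of unipotent elements in GL(n, F_q) is q^(n(n-1)/2) squared, i.e. q^(n(n-1)). -/
open Module

namespace UniCount

variable {F V : Type*} [Field F] [AddCommGroup V] [Module F V]

/-- Endomorphisms that agree modulo `W` and preserve `W` have powers that agree modulo `W`. -/
lemma pow_sub_mem (W : Submodule F V) (S T : V →ₗ[F] V) (hT : ∀ w ∈ W, T w ∈ W)
    (hD : ∀ y, S y - T y ∈ W) (i : ℕ) (y : V) : (S ^ i) y - (T ^ i) y ∈ W := by
  induction i with
  | zero => simp
  | succ i ih =>
    rw [pow_succ', pow_succ', Module.End.mul_apply, Module.End.mul_apply]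
    have h1 := hT _ ih
    have h2 := hD ((S ^ i) y)
    rw [map_sub] at h1
    have := W.add_mem h2 h1
    rwa [sub_add_sub_cancel] at this

/-- Endomorphisms of `V` preserving `W`, with given restriction, nilpotent modulo `W`. -/
abbrev Ext (W : Submodule F V) (n : ℕ) {X : Type*} (f : X → (W →ₗ[F] W)) : Type _ :=
  {p : (V →ₗ[F] V) × X // (∀ w : W, p.1 w = f p.2 w) ∧ ∀ y, (p.1 ^ n) y ∈ W}

lemma extEquiv (W : Submodule F V) (n : ℕ) {X : Type*} (f : X → (W →ₗ[F] W)) :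
    Nonempty (Ext W n f ≃ {S : V →ₗ[F] V // (∀ w : W, S w = 0) ∧ ∀ y, (S ^ n) y ∈ W} × X) := by
  obtain ⟨p, hp⟩ := W.subtype.exists_leftInverse_of_injective (by simp)
  have hp' : ∀ w : W, p w = w := fun w => LinearMap.congr_fun hp w
  refine ⟨⟨fun T => (⟨T.1.1 - W.subtype ∘ₗ f T.1.2 ∘ₗ p, ?_, ?_⟩, T.1.2),
    fun S => ⟨(S.1.1 + W.subtype ∘ₗ f S.2 ∘ₗ p, S.2), ?_, ?_⟩, ?_, ?_⟩⟩
  · intro w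
    simp [hp', T.2.1 w]
  · intro y
    have h := pow_sub_mem W (T.1.1 - W.subtype ∘ₗ f T.1.2 ∘ₗ p) T.1.1
      (fun w hw => by rw [T.2.1 ⟨w, hw⟩]; exact Subtype.property _)
      (fun y => by simp) n y
    have := W.add_mem h (T.2.2 y)
    rwa [sub_add_cancel] at this
  · intro w
    simp [hp', S.1.2.1 w]
  · intro y
    have h := pow_sub_mem W (S.1.1 + W.subtype ∘ₗ f S.2 ∘ₗ p) S.1.1
      (fun w hw => by rw [S.1.2.1 ⟨w, hw⟩]; exact W.zero_mem)
      (fun y => by simp) n y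
    have := W.add_mem h (S.1.2.2 y)
    rwa [sub_add_cancel] at this
  · rintro ⟨⟨T, x⟩, h⟩
    simp
  · rintro ⟨⟨S, h⟩, x⟩
    simp

lemma nilp_pow [FiniteDimensional F V] {M : V →ₗ[F] V} {m : ℕ} (h : M ^ m = 0) :
    M ^ finrank F V = 0 := by
  have h1 : IsNilpotent M := ⟨m, h⟩
  have h2 := LinearMap.aeval_self_charpoly M
  rw [(LinearMap.charpoly_eq_X_pow_iff M).2 (fun x => ⟨m, by simp [h]⟩)] at h2
  simpa using h2

/-- Nilpotent endomorphisms with a cyclic vector. -/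
abbrev Cyc (F W : Type*) [Field F] [AddCommGroup W] [Module F W] (n : ℕ) : Type _ :=
  {p : (W →ₗ[F] W) × W // p.1 ^ n = 0 ∧ Submodule.span F (Set.range fun i : ℕ => (p.1 ^ i) p.2) = ⊤}

lemma cyc_span_fin [FiniteDimensional F V] {n : ℕ} (c : Cyc F V n) :
    ⊤ ≤ Submodule.span F (Set.range fun i : Fin (finrank F V) => (c.1.1 ^ (i : ℕ)) c.1.2) := by
  refine c.2.2.ge.trans ?_
  rw [Submodule.span_le]
  rintro _ ⟨i, rfl⟩
  by_cases hi : i < finrank F V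
  · exact Submodule.subset_span ⟨⟨i, hi⟩, rfl⟩
  · have : c.1.1 ^ i = 0 := pow_eq_zero_of_le (not_lt.1 hi) (nilp_pow c.2.1)
    simp [this]

lemma cycEquiv [FiniteDimensional F V] (n : ℕ) (hn : finrank F V ≤ n) :
    Nonempty (Cyc F V n ≃ (V ≃ₗ[F] V)) := by
  have e1 : (V ≃ₗ[F] V) ≃ Basis (Fin (finrank F V)) F V :=
    ⟨fun e => (finBasis F V).map e, fun b => (finBasis F V).equiv b (Equiv.refl _),
      fun e => by
        apply LinearEquiv.toLinearMap_injective
        apply (finBasis F V).ext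
        intro i
        simp, fun b => by ext i; simp⟩
  let g : Cyc F V n → Basis (Fin (finrank F V)) F V := fun c =>
    basisOfTopLeSpanOfCardEqFinrank _ (cyc_span_fin c) (by simp)
  have hg : ∀ c i, g c i = (c.1.1 ^ (i : ℕ)) c.1.2 := fun c i => by simp [g]
  have hbij : Function.Bijective g := by
    constructor
    · intro c d hcd
      have key : ∀ i : ℕ, (c.1.1 ^ i) c.1.2 = (d.1.1 ^ i) d.1.2 := by
        intro i
        by_cases hi : i < finrank F V
        · rw [← hg c ⟨i, hi⟩, hcd, hg]
        · have h1 : c.1.1 ^ i = 0 := pow_eq_zero_of_le (not_lt.1 hi) (nilp_pow c.2.1)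
          have h2 : d.1.1 ^ i = 0 := pow_eq_zero_of_le (not_lt.1 hi) (nilp_pow d.2.1)
          simp [h1, h2]
      apply Subtype.ext
      apply Prod.ext
      · apply (g c).ext
        intro i
        have := key (i + 1)
        rw [pow_succ', pow_succ', Module.End.mul_apply, Module.End.mul_apply] at this
        rw [← key i] at this
        rw [hg, this]
      · simpa using key 0
    · intro b
      let w : ℕ → V := fun i => if h : i < finrank F V then b ⟨i, h⟩ else 0
      let M : V →ₗ[F] V := b.constr F (fun i => w (i + 1))
      have hM : ∀ i, M (w i) = w (i + 1) := by
        intro i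
        by_cases hi : i < finrank F V
        · have : w i = b ⟨i, hi⟩ := by simp [w, hi]
          rw [this, Basis.constr_basis]
        · have h1 : w i = 0 := by simp [w, hi]
          have h2 : w (i + 1) = 0 := by
            have : ¬ (i + 1 < finrank F V) := by omega
            simp [w, this]
          rw [h1, h2, map_zero]
      have hMj : ∀ j i, (M ^ j) (w i) = w (i + j) := by
        intro j
        induction j with
        | zero => simp
        | succ j ih =>
          intro i
          rw [pow_succ', Module.End.mul_apply, ih, hM, add_assoc]
      have hb : ∀ i : Fin (finrank F V), w i = b i := fun i => by simp [w]
      have hc1 : M ^ n = 0 := by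
        apply b.ext
        intro i
        rw [← hb, hMj]
        have : ¬ ((i : ℕ) + n < finrank F V) := by omega
        simp [w, this]
      have hc2 : Submodule.span F (Set.range fun i : ℕ => (M ^ i) (w 0)) = ⊤ := by
        rw [eq_top_iff, ← b.span_eq]
        apply Submodule.span_mono
        rintro _ ⟨i, rfl⟩
        exact ⟨i, by simp only [hMj, zero_add, hb]⟩
      refine ⟨⟨(M, w 0), hc1, hc2⟩, ?_⟩
      ext i
      rw [hg]
      simp only [hMj, zero_add, hb]
  exact ⟨(Equiv.ofBijective g hbij).trans e1.symm⟩

lemma pow_restrict {W : Submodule F V} {T : V →ₗ[F] V} {M : W →ₗ[F] W}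
    (h : ∀ w : W, T w = M w) (i : ℕ) (w : W) : (T ^ i) w = (M ^ i) w := by
  induction i with
  | zero => simp
  | succ i ih => rw [pow_succ', pow_succ', Module.End.mul_apply, Module.End.mul_apply, ih, h]

lemma map_range_pow [FiniteDimensional F V] (T : V →ₗ[F] V) :
    LinearMap.range (T ^ (finrank F V + 1)) = LinearMap.range (T ^ finrank F V) := by
  apply Submodule.eq_of_le_of_finrank_eq
  · rw [pow_succ]
    exact LinearMap.range_comp_le_range _ _
  · have h1 := LinearMap.finrank_range_add_finrank_ker (T ^ (finrank F V + 1))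
    have h2 := LinearMap.finrank_range_add_finrank_ker (T ^ finrank F V)
    have h3 : LinearMap.ker (T ^ (finrank F V + 1)) = LinearMap.ker (T ^ finrank F V) :=
      Module.End.ker_pow_eq_ker_pow_finrank_of_le (Nat.le_succ _)
    rw [h3] at h1
    omega

lemma fibre1 [FiniteDimensional F V] (W : Submodule F V) :
    Nonempty ({T : V →ₗ[F] V // LinearMap.range (T ^ finrank F V) = W} ≃
      Ext W (finrank F V) (fun e : W ≃ₗ[F] W => (e : W →ₗ[F] W))) := by
  let g : Ext W (finrank F V) (fun e : W ≃ₗ[F] W => (e : W →ₗ[F] W)) →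
      {T : V →ₗ[F] V // LinearMap.range (T ^ finrank F V) = W} := fun p => ⟨p.1.1, by
    apply le_antisymm
    · rintro _ ⟨y, rfl⟩
      exact p.2.2 y
    · intro w hw
      have hs : Function.Surjective ((p.1.2 : W →ₗ[F] W) ^ finrank F V) := by
        rw [Module.End.coe_pow]
        exact p.1.2.surjective.iterate _
      obtain ⟨u, hu⟩ := hs ⟨w, hw⟩
      exact ⟨u, by rw [pow_restrict p.2.1, hu]⟩⟩
  refine ⟨(Equiv.ofBijective g ⟨?_, ?_⟩).symm⟩
  · intro p r h
    have h1 : p.1.1 = r.1.1 := congrArg Subtype.val h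
    apply Subtype.ext
    apply Prod.ext h1
    ext w
    have h2 := p.2.1 w
    have h3 := r.2.1 w
    rw [h1] at h2
    exact h2.symm.trans h3
  · rintro ⟨T, rfl⟩
    have hm : ∀ w ∈ LinearMap.range (T ^ finrank F V), T w ∈ LinearMap.range (T ^ finrank F V) := by
      rintro _ ⟨y, rfl⟩
      exact ⟨T y, by rw [← Module.End.mul_apply, ← Module.End.mul_apply, ← pow_succ, ← pow_succ']⟩
    have hs : Function.Surjective (T.restrict hm) := by
      rintro ⟨w, hw⟩
      have hw' := hw
      rw [← map_range_pow] at hw'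
      obtain ⟨y, hy⟩ := hw'
      refine ⟨⟨(T ^ finrank F V) y, y, rfl⟩, Subtype.ext ?_⟩
      rw [pow_succ'] at hy
      exact hy
    refine ⟨⟨(T, LinearEquiv.ofBijective (T.restrict hm)
      ⟨LinearMap.injective_iff_surjective.2 hs, hs⟩), ?_, ?_⟩, rfl⟩
    · intro w; rfl
    · intro y; exact ⟨y, rfl⟩

lemma fibre2 [FiniteDimensional F V] (W : Submodule F V) :
    Nonempty ({p : {T : V →ₗ[F] V // T ^ finrank F V = 0} × V //
        Submodule.span F (Set.range fun i : ℕ => (p.1.1 ^ i) p.2) = W} ≃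
      Ext W (finrank F V) (fun c : Cyc F W (finrank F V) => c.1.1)) := by
  have hspan : ∀ (T : V →ₗ[F] V) (M : W →ₗ[F] W) (v : W), (∀ w : W, T w = M w) →
      Submodule.span F (Set.range fun i : ℕ => (T ^ i) (v : V)) =
      (Submodule.span F (Set.range fun i : ℕ => (M ^ i) v)).map W.subtype := by
    intro T M v h
    rw [Submodule.map_span, ← Set.range_comp]
    congr 2
    ext i
    simp [pow_restrict h]
  let g : Ext W (finrank F V) (fun c : Cyc F W (finrank F V) => c.1.1) →
      {p : {T : V →ₗ[F] V // T ^ finrank F V = 0} × V //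
        Submodule.span F (Set.range fun i : ℕ => (p.1.1 ^ i) p.2) = W} := fun p =>
    ⟨(⟨p.1.1, by
      apply nilp_pow (m := finrank F V + finrank F V)
      ext y
      rw [pow_add, Module.End.mul_apply]
      have := pow_restrict p.2.1 (finrank F V) ⟨_, p.2.2 y⟩
      rw [p.1.2.2.1] at this
      simpa using this⟩, (p.1.2.1.2 : V)), by
      have := hspan p.1.1 p.1.2.1.1 p.1.2.1.2 p.2.1
      rw [p.1.2.2.2] at this
      simpa using this⟩
  refine ⟨(Equiv.ofBijective g ⟨?_, ?_⟩).symm⟩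
  · intro p r h
    have h0 := congrArg Subtype.val h
    have h1 : p.1.1 = r.1.1 := congrArg (fun z => z.1.1) h0
    have h4 : (p.1.2.1.2 : V) = r.1.2.1.2 := congrArg (fun z => z.2) h0
    apply Subtype.ext
    apply Prod.ext h1
    apply Subtype.ext
    apply Prod.ext
    · ext w
      have h2 := p.2.1 w
      have h3 := r.2.1 w
      rw [h1] at h2
      exact h2.symm.trans h3
    · exact Subtype.ext h4
  · rintro ⟨⟨⟨T, hT⟩, v⟩, hW⟩
    simp only at hW
    have hv : v ∈ W := by
      rw [← hW]
      exact Submodule.subset_span ⟨0, by simp⟩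
    have hm : ∀ w ∈ W, T w ∈ W := by
      have : W ≤ W.comap T := by
        conv_lhs => rw [← hW]
        rw [Submodule.span_le]
        rintro _ ⟨i, rfl⟩
        change T ((T ^ i) v) ∈ W
        rw [← hW]
        exact Submodule.subset_span ⟨i + 1, by simp only [pow_succ', Module.End.mul_apply]⟩
      exact this
    have hr : ∀ w : W, T w = T.restrict hm w := fun w => rfl
    refine ⟨⟨(T, ⟨(T.restrict hm, ⟨v, hv⟩), ?_, ?_⟩), hr, ?_⟩, rfl⟩
    · ext w
      rw [← pow_restrict hr, hT]
      simp
    · apply Submodule.map_injective_of_injective W.injective_subtype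
      rw [← hspan T _ ⟨v, hv⟩ hr]
      simpa using hW
    · intro y
      simp [hT]

lemma main_equiv [FiniteDimensional F V] :
    Nonempty ((V →ₗ[F] V) ≃ {T : V →ₗ[F] V // T ^ finrank F V = 0} × V) := by
  have h : ∀ W : Submodule F V,
      Nonempty ({T : V →ₗ[F] V // LinearMap.range (T ^ finrank F V) = W} ≃
      {p : {T : V →ₗ[F] V // T ^ finrank F V = 0} × V //
        Submodule.span F (Set.range fun i : ℕ => (p.1.1 ^ i) p.2) = W}) := by
    intro W
    obtain ⟨a⟩ := fibre1 W
    obtain ⟨b⟩ := fibre2 W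
    obtain ⟨c⟩ := extEquiv W (finrank F V) (fun e : W ≃ₗ[F] W => (e : W →ₗ[F] W))
    obtain ⟨d⟩ := extEquiv W (finrank F V) (fun c : Cyc F W (finrank F V) => c.1.1)
    obtain ⟨e⟩ := cycEquiv (F := F) (V := W) (finrank F V) (Submodule.finrank_le W)
    exact ⟨a.trans (c.trans (((Equiv.refl _).prodCongr e.symm).trans (d.symm.trans b.symm)))⟩
  let e := fun W => (h W).some
  exact ⟨(Equiv.sigmaFiberEquiv _).symm.trans
    ((Equiv.sigmaCongrRight e).trans (Equiv.sigmaFiberEquiv _))⟩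

end UniCount

/-- The number of unipotent elements in `GL(n, F_q)` (matrices `A` with `(A - 1) ^ n = 0`)
is `(q ^ (n(n-1)/2)) ^ 2 = q ^ (n(n-1))`, where `q` is the cardinality of the finite field. -/
theorem card_unipotent_GL (F : Type*) [Field F] [Fintype F] (n : ℕ) :
    Nat.card {A : Matrix.GeneralLinearGroup (Fin n) F |
        ((A : Matrix (Fin n) (Fin n) F) - 1) ^ n = 0} =
      (Fintype.card F ^ (n * (n - 1) / 2)) ^ 2 := by
  have e1 : {A : Matrix.GeneralLinearGroup (Fin n) F |
        ((A : Matrix (Fin n) (Fin n) F) - 1) ^ n = 0} ≃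
      {M : Matrix (Fin n) (Fin n) F // M ^ n = 0} := by
    refine Equiv.ofBijective (fun A => ⟨(A.1 : Matrix (Fin n) (Fin n) F) - 1, A.2⟩) ⟨?_, ?_⟩
    · intro A B h
      have := congrArg Subtype.val h
      exact Subtype.ext (Units.ext (sub_left_injective this))
    · rintro ⟨M, hM⟩
      have hN : IsNilpotent M := ⟨n, hM⟩
      obtain ⟨u, hu⟩ := hN.isUnit_one_add
      refine ⟨⟨u, ?_⟩, ?_⟩
      · simp [hu, hM]
      · simp [hu]
  have e2 : {M : Matrix (Fin n) (Fin n) F // M ^ n = 0} ≃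
      {T : (Fin n → F) →ₗ[F] (Fin n → F) // T ^ finrank F (Fin n → F) = 0} :=
    (Matrix.toLinAlgEquiv' (R := F) (n := Fin n)).toEquiv.subtypeEquiv (by
      intro M
      rw [finrank_fin_fun]
      change _ ↔ (Matrix.toLinAlgEquiv' M) ^ n = 0
      rw [← map_pow, EmbeddingLike.map_eq_zero_iff])
  obtain ⟨e3⟩ := UniCount.main_equiv (F := F) (V := Fin n → F)
  have h3 := Nat.card_congr e3
  rw [Nat.card_prod, ← Nat.card_congr e2, ← Nat.card_congr e1,
    ← Nat.card_congr (Matrix.toLinAlgEquiv' (R := F) (n := Fin n)).toEquiv] at h3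
  have h4 : Nat.card (Matrix (Fin n) (Fin n) F) = Fintype.card F ^ (n * n) := by
    change Nat.card (Fin n → Fin n → F) = _
    simp [pow_mul]
  have h5 : Nat.card (Fin n → F) = Fintype.card F ^ n := by
    simp
  rw [h4, h5] at h3
  have hq : 0 < Fintype.card F ^ n := pow_pos Fintype.card_pos _
  apply Nat.eq_of_mul_eq_mul_right hq
  rw [← h3, ← pow_mul, ← pow_add]
  congr 1
  rw [Nat.div_mul_cancel (Nat.even_mul_pred_self n).two_dvd]
  cases n with
  | zero => rfl
  | succ m => simp; ring
end
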